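/- Equivalence of topologies induced by the cut distances: let d_m and d_m' be two distances on ℳ≤1(Z), each inducing the weak topology on ℳ≤1(Z), and such that the cut distances d_{□,m} and d_{□,m'} on 𝒲₁ are each smooth, weakly regular and regular with respect to the stepping operator (cut distances are automatically invariant). Then δ_{□,m} and δ_{□,m'} induce the same topology on the quotient space 𝒲̃₁ of probability-graphons modulo weak isomorphism; equivalently, for every sequence (W_n) and every W in 𝒲₁, δ_{□,m}(W_n, W) → 0 if and only if δ_{□,m'}(W_n, W) → 0. -/

import Mathlib

open MeasureTheory Filter Topology
open scoped ENNReal NNReal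

noncomputable section

namespace PG

/-- The unit square `[0,1]²`, with its product Lebesgue measure. -/
abbrev Sq : Type := unitInterval × unitInterval

variable {Z : Type*} [MeasurableSpace Z] [TopologicalSpace Z]

/-! ### Measure-valued kernels and probability-graphons -/

/-- `W(A;·) = ∫_A W(x,y;·) dx dy` for a measure-valued kernel. -/
def kernelInt (W : Sq → Measure Z) (A : Set Sq) : Measure Z :=
  ((volume : Measure Sq).restrict A).bind W

/-- The measure `M_W = W([0,1]²;·)` associated with a (positive) measure-valued kernel. -/
def MW (W : Sq → Measure Z) : Measure Z := (volume : Measure Sq).bind W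

/-- A probability-graphon: a measurable map from `[0,1]²` to probability measures on `Z`. -/
def IsProbGraphon (W : Sq → Measure Z) : Prop :=
  (∀ A : Set Z, MeasurableSet A → Measurable fun p => W p A) ∧
    ∀ p, IsProbabilityMeasure (W p)

/-- Essential supremum of the total mass of a positive measure-valued kernel. -/
def TVboundPos (W : Sq → Measure Z) : ℝ≥0∞ :=
  essSup (fun p => W p Set.univ) (volume : Measure Sq)

/-- A (positive) measure-valued kernel: measurable and essentially bounded. -/
def IsPosKernel (W : Sq → Measure Z) : Prop :=
  (∀ A : Set Z, MeasurableSet A → Measurable fun p => W p A) ∧ TVboundPos W < ⊤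

/-- Relabeling `W^φ` of a kernel by a map `φ : [0,1] → [0,1]`. -/
def relabel (W : Sq → Measure Z) (φ : unitInterval → unitInterval) : Sq → Measure Z :=
  fun p => W (φ p.1, φ p.2)

/-- `φ` is a Lebesgue-measure-preserving map of `[0,1]`. -/
def IsMP (φ : unitInterval → unitInterval) : Prop :=
  MeasurePreserving φ (volume : Measure unitInterval) (volume : Measure unitInterval)

/-- Weak convergence of a sequence of (finite) measures on `Z`. -/
def WeakTendsto (μ : ℕ → Measure Z) (ν : Measure Z) : Prop :=
  ∀ f : BoundedContinuousFunction Z ℝ,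
    Tendsto (fun n => ∫ x, f x ∂(μ n)) atTop (𝓝 (∫ x, f x ∂ν))

/-- The cut distance `d_{□,m}` associated with a distance `d_m` on measures. -/
def cutDist (dm : Measure Z → Measure Z → ℝ) (U W : Sq → Measure Z) : ℝ :=
  ⨆ ST : {p : Set unitInterval × Set unitInterval // MeasurableSet p.1 ∧ MeasurableSet p.2},
    dm (kernelInt U (ST.val.1 ×ˢ ST.val.2)) (kernelInt W (ST.val.1 ×ˢ ST.val.2))

/-- The unlabeled cut distance `δ_□` associated with a distance `d` on kernels:
`δ_□(U,W) = inf_{φ ∈ S_{[0,1]}} d(U, W^φ)`. -/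
def deltaCut (d : (Sq → Measure Z) → (Sq → Measure Z) → ℝ) (U W : Sq → Measure Z) : ℝ :=
  ⨅ φ : {φ : unitInterval → unitInterval // IsMP φ ∧ Function.Bijective φ},
    d U (relabel W φ.val)

/-- Weak isomorphism of kernels: `U^φ = W^ψ` a.e. for some measure-preserving `φ, ψ`. -/
def WeakIso (U W : Sq → Measure Z) : Prop :=
  ∃ φ ψ : unitInterval → unitInterval, IsMP φ ∧ IsMP ψ ∧
    relabel U φ =ᵐ[(volume : Measure Sq)] relabel W ψ

/-- A family of kernels is tight if the family of measures `{M_W}` is tight. -/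
def TightFamily (K : Set (Sq → Measure Z)) : Prop :=
  ∀ ε : ℝ≥0∞, 0 < ε → ∃ K₀ : Set Z, IsCompact K₀ ∧ ∀ W ∈ K, MW W K₀ᶜ ≤ ε

/-- Invariance of a distance on probability-graphons under bijective
measure-preserving relabelings. -/
def Invariant (d : (Sq → Measure Z) → (Sq → Measure Z) → ℝ) : Prop :=
  ∀ U W : Sq → Measure Z, IsProbGraphon U → IsProbGraphon W →
    ∀ φ : unitInterval → unitInterval, IsMP φ → Function.Bijective φ →
      d (relabel U φ) (relabel W φ) = d U W

/-- Smoothness of a distance on probability-graphons: a.e. weak convergence implies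
convergence in `d`. -/
def Smooth (d : (Sq → Measure Z) → (Sq → Measure Z) → ℝ) : Prop :=
  ∀ (Wn : ℕ → Sq → Measure Z) (W : Sq → Measure Z),
    (∀ n, IsProbGraphon (Wn n)) → IsProbGraphon W →
    (∀ᵐ p ∂(volume : Measure Sq), WeakTendsto (fun n => Wn n p) (W p)) →
    Tendsto (fun n => d (Wn n) W) atTop (𝓝 0)

/-- `d` is a distance on the space `𝒲₁` of probability-graphons (where kernels that
agree a.e. are identified). -/
def IsGraphonDist (d : (Sq → Measure Z) → (Sq → Measure Z) → ℝ) : Prop :=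
  (∀ U W, IsProbGraphon U → IsProbGraphon W → d U W = d W U) ∧
  (∀ U W, IsProbGraphon U → IsProbGraphon W → 0 ≤ d U W) ∧
  (∀ U V W, IsProbGraphon U → IsProbGraphon V → IsProbGraphon W → d U W ≤ d U V + d V W) ∧
  (∀ U W, IsProbGraphon U → IsProbGraphon W →
    (d U W = 0 ↔ U =ᵐ[(volume : Measure Sq)] W))

/-- Distance axioms for `d` on a subset `M`. -/
def IsDistOnSet {α : Type*} (M : Set α) (d : α → α → ℝ) : Prop :=
  (∀ x ∈ M, ∀ y ∈ M, d x y = d y x) ∧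
  (∀ x ∈ M, ∀ y ∈ M, 0 ≤ d x y) ∧
  (∀ x ∈ M, ∀ y ∈ M, ∀ z ∈ M, d x z ≤ d x y + d y z) ∧
  (∀ x ∈ M, ∀ y ∈ M, (d x y = 0 ↔ x = y))

/-- The set `ℳ≤1(Z)` of measures of total mass at most one. -/
def SubProb (Z : Type*) [MeasurableSpace Z] : Set (Measure Z) := {μ | μ Set.univ ≤ 1}

/-- `d_m` is a distance on `ℳ≤1(Z)`. -/
def IsDistOnSubProb (dm : Measure Z → Measure Z → ℝ) : Prop :=
  IsDistOnSet (SubProb Z) dm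

/-- `d_m` induces the weak topology on `ℳ≤1(Z)` (sequential formulation; the weak
topology on `ℳ≤1(Z)` is metrizable, so it is characterized by its convergent
sequences). -/
def InducesWeakTopologySub (dm : Measure Z → Measure Z → ℝ) : Prop :=
  ∀ (μn : ℕ → Measure Z) (μ : Measure Z), (∀ n, μn n ∈ SubProb Z) → μ ∈ SubProb Z →
    (Tendsto (fun n => dm (μn n) μ) atTop (𝓝 0) ↔ WeakTendsto μn μ)

/-- Quasi-convexity of a distance on the convex set `ℳ₊(Z)` of finite measures. -/
def QuasiConvexPos (dm : Measure Z → Measure Z → ℝ) : Prop :=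
  ∀ μ₁ μ₂ ν₁ ν₂ : Measure Z, IsFiniteMeasure μ₁ → IsFiniteMeasure μ₂ →
    IsFiniteMeasure ν₁ → IsFiniteMeasure ν₂ → ∀ a : ℝ≥0∞, a ≤ 1 →
    dm (a • μ₁ + (1 - a) • μ₂) (a • ν₁ + (1 - a) • ν₂) ≤ max (dm μ₁ ν₁) (dm μ₂ ν₂)

/-! ### Finite partitions of `[0,1]` and the stepping operator -/

/-- A finite measurable partition of `[0,1]` (possibly with empty classes). -/
structure FinPartition : Type where
  n : ℕ
  part : Fin n → Set unitInterval
  measurableSet : ∀ i, MeasurableSet (part i)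
  disjoint : ∀ i j, i ≠ j → Disjoint (part i) (part j)
  covers : (⋃ i, part i) = Set.univ

/-- `P` refines `Q`: every class of `P` is included in a class of `Q`. -/
def FinPartition.Refines (P Q : FinPartition) : Prop :=
  ∀ i, ∃ j, P.part i ⊆ Q.part j

/-- The stepping `W_𝒫` of a (positive) measure-valued kernel `W` with respect to a
finite partition `𝒫`: on `S_i × S_j` it equals `W(S_i×S_j;·)/(λ(S_i)λ(S_j))`
(and the zero measure on classes of zero measure). -/
def stepping (W : Sq → Measure Z) (P : FinPartition) : Sq → Measure Z :=
  fun p => ∑ i : Fin P.n, ∑ j : Fin P.n,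
    Set.indicator (P.part i ×ˢ P.part j)
      (fun _ => ((volume (P.part i)) * (volume (P.part j)))⁻¹ •
        kernelInt W (P.part i ×ˢ P.part j)) p

/-- Weak regularity of a distance on probability-graphons. -/
def WeaklyRegular (d : (Sq → Measure Z) → (Sq → Measure Z) → ℝ) : Prop :=
  ∀ K : Set (Sq → Measure Z), (∀ W ∈ K, IsProbGraphon W) → TightFamily K →
    ∀ ε : ℝ, 0 < ε → ∃ m : ℕ, 0 < m ∧
      ∀ W ∈ K, ∀ Q : FinPartition, ∃ P : FinPartition,
        P.Refines Q ∧ P.n ≤ m * Q.n ∧ d W (stepping W P) < ε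

/-- Regularity of a distance on probability-graphons with respect to the stepping
operator. -/
def SteppingRegular (d : (Sq → Measure Z) → (Sq → Measure Z) → ℝ) : Prop :=
  ∃ C₀ : ℝ, 0 < C₀ ∧ ∀ W U : Sq → Measure Z, IsProbGraphon W → IsProbGraphon U →
    ∀ P : FinPartition, d W (stepping W P) ≤ C₀ * d W (stepping U P)

/-! ### Signed measure-valued kernels -/

/-- The signed measure associated with a finite measure (and junk value `0` on
non-finite measures). -/
def toSigned (μ : Measure Z) : SignedMeasure Z :=
  letI := Classical.dec (IsFiniteMeasure μ)
  if h : IsFiniteMeasure μ then @Measure.toSignedMeasure Z _ μ h else 0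

/-- `W(A;·)` for a signed measure-valued kernel. -/
def skernelInt (W : Sq → SignedMeasure Z) (A : Set Sq) : SignedMeasure Z :=
  toSigned (((volume : Measure Sq).restrict A).bind
      fun p => (W p).toJordanDecomposition.posPart)
    - toSigned (((volume : Measure Sq).restrict A).bind
      fun p => (W p).toJordanDecomposition.negPart)

/-- Total mass `‖s‖_TV` of the total variation of a signed measure. -/
def TVnorm (s : SignedMeasure Z) : ℝ≥0∞ := s.totalVariation Set.univ

/-- `‖W‖∞`, the essential supremum of the total variation masses of a signed
measure-valued kernel. -/
def TVbound (W : Sq → SignedMeasure Z) : ℝ≥0∞ :=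
  essSup (fun p => TVnorm (W p)) (volume : Measure Sq)

/-- A signed measure-valued kernel: measurable in `(x,y)` and essentially bounded in
total variation. -/
def IsSignedKernel (W : Sq → SignedMeasure Z) : Prop :=
  (∀ A : Set Z, MeasurableSet A → Measurable fun p => W p A) ∧ TVbound W < ⊤

/-- The measure `M_W = ∫ |W|(x,y;·) dx dy` of a signed measure-valued kernel. -/
def MWs (W : Sq → SignedMeasure Z) : Measure Z :=
  (volume : Measure Sq).bind fun p => (W p).totalVariation

/-- Tightness for a family of signed measure-valued kernels. -/
def TightFamilyS (K : Set (Sq → SignedMeasure Z)) : Prop :=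
  ∀ ε : ℝ≥0∞, 0 < ε → ∃ K₀ : Set Z, IsCompact K₀ ∧ ∀ W ∈ K, MWs W K₀ᶜ ≤ ε

/-- Integral of a bounded continuous function against a signed measure. -/
def sint (f : BoundedContinuousFunction Z ℝ) (s : SignedMeasure Z) : ℝ :=
  ∫ x, f x ∂s.toJordanDecomposition.posPart - ∫ x, f x ∂s.toJordanDecomposition.negPart

/-- Weak convergence of signed measures. -/
def WeakTendstoS (s : ℕ → SignedMeasure Z) (t : SignedMeasure Z) : Prop :=
  ∀ f : BoundedContinuousFunction Z ℝ,
    Tendsto (fun n => sint f (s n)) atTop (𝓝 (sint f t))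

/-- Stepping of a signed measure-valued kernel with respect to a finite partition. -/
def steppingS (W : Sq → SignedMeasure Z) (P : FinPartition) : Sq → SignedMeasure Z :=
  fun p => ∑ i : Fin P.n, ∑ j : Fin P.n,
    Set.indicator (P.part i ×ˢ P.part j)
      (fun _ => (((volume (P.part i)).toReal * (volume (P.part j)).toReal)⁻¹ : ℝ) •
        skernelInt W (P.part i ×ˢ P.part j)) p

/-- Cut distance for signed measure-valued kernels associated with a distance `d_m`
on signed measures. -/
def cutDistS (dm : SignedMeasure Z → SignedMeasure Z → ℝ) (U W : Sq → SignedMeasure Z) : ℝ :=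
  ⨆ ST : {p : Set unitInterval × Set unitInterval // MeasurableSet p.1 ∧ MeasurableSet p.2},
    dm (skernelInt U (ST.val.1 ×ˢ ST.val.2)) (skernelInt W (ST.val.1 ×ˢ ST.val.2))

/-- Quasi-convexity of a distance on a convex subset `M` of signed measures. -/
def QuasiConvexOn (M : Set (SignedMeasure Z)) (dm : SignedMeasure Z → SignedMeasure Z → ℝ) :
    Prop :=
  ∀ x₁ ∈ M, ∀ x₂ ∈ M, ∀ y₁ ∈ M, ∀ y₂ ∈ M, ∀ a : ℝ, 0 ≤ a → a ≤ 1 →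
    dm (a • x₁ + (1 - a) • x₂) (a • y₁ + (1 - a) • y₂) ≤ max (dm x₁ y₁) (dm x₂ y₂)

/-! ### Convergence determining sequences and the associated norms -/

/-- `F` is a convergence determining sequence: `[0,1]`-valued bounded continuous
functions, `F 0 = 1`, such that convergence of all moments `μ(f_k)` implies weak
convergence (for finite positive measures). -/
def IsConvDet (F : ℕ → BoundedContinuousFunction Z ℝ) : Prop :=
  F 0 = 1 ∧ (∀ k x, F k x ∈ Set.Icc (0:ℝ) 1) ∧
  ∀ (μn : ℕ → Measure Z) (μ : Measure Z), (∀ n, IsFiniteMeasure (μn n)) → IsFiniteMeasure μ →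
    (∀ k, Tendsto (fun n => ∫ x, F k x ∂(μn n)) atTop (𝓝 (∫ x, F k x ∂μ))) →
    WeakTendsto μn μ

/-- `‖μ − ν‖_F = Σ_k 2^{-k} |μ(f_k) − ν(f_k)|` for positive measures. -/
def Fdist (F : ℕ → BoundedContinuousFunction Z ℝ) (μ ν : Measure Z) : ℝ :=
  ∑' k : ℕ, (1/2 : ℝ) ^ k * |∫ x, F k x ∂μ - ∫ x, F k x ∂ν|

/-- The cut distance `d_{□,F}(U,W) = ‖U − W‖_{□,F}` on measure-valued kernels. -/
def cutDistF (F : ℕ → BoundedContinuousFunction Z ℝ) (U W : Sq → Measure Z) : ℝ :=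
  ⨆ ST : {p : Set unitInterval × Set unitInterval // MeasurableSet p.1 ∧ MeasurableSet p.2},
    Fdist F (kernelInt U (ST.val.1 ×ˢ ST.val.2)) (kernelInt W (ST.val.1 ×ˢ ST.val.2))

/-- The norm `‖s‖_F` of a signed measure. -/
def FnormS (F : ℕ → BoundedContinuousFunction Z ℝ) (s : SignedMeasure Z) : ℝ :=
  ∑' k : ℕ, (1/2 : ℝ) ^ k * |sint (F k) s|

/-- The cut norm `‖W‖_{□,F}` of a signed measure-valued kernel. -/
def cutNormFS (F : ℕ → BoundedContinuousFunction Z ℝ) (W : Sq → SignedMeasure Z) : ℝ :=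
  ⨆ ST : {p : Set unitInterval × Set unitInterval // MeasurableSet p.1 ∧ MeasurableSet p.2},
    FnormS F (skernelInt W (ST.val.1 ×ˢ ST.val.2))

/-- The norm `‖W‖_{2,F}` of a signed measure-valued kernel. -/
def norm2F (F : ℕ → BoundedContinuousFunction Z ℝ) (W : Sq → SignedMeasure Z) : ℝ :=
  Real.sqrt (∑' k : ℕ, (1/2 : ℝ) ^ k * ∫ p, (sint (F k) (W p)) ^ 2 ∂(volume : Measure Sq))

/-! ### Homomorphism densities and sampling -/

/-- The homomorphism density `t(F^g, W)` of a `C_b(Z)`-decorated finite directed graph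
with vertex set `Fin v` and edge set `E` in a measure-valued kernel `W`. -/
def homDensity {v : ℕ} (E : Finset (Fin v × Fin v))
    (g : Fin v × Fin v → BoundedContinuousFunction Z ℝ) (W : Sq → Measure Z) : ℝ :=
  ∫ x : Fin v → unitInterval,
    (∏ e ∈ E, ∫ z, g e z ∂(W (x e.1, x e.2))) ∂(volume : Measure (Fin v → unitInterval))

/-- The edge set of the complete directed graph on `k` vertices. -/
def completeEdges (k : ℕ) : Finset (Fin k × Fin k) :=
  Finset.univ.filter fun e => e.1 ≠ e.2

/-- The `i`-th step `((i)/k, (i+1)/k]` of the uniform partition of `[0,1]` into `k`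
intervals. -/
def stepSet (k : ℕ) (i : Fin k) : Set unitInterval :=
  {t | (i : ℝ) / k < (t : ℝ) ∧ (t : ℝ) ≤ ((i : ℝ) + 1) / k}

/-- The stepfunction `W_x` sampled from `W` at the points `x = (x₁, …, x_k)`. -/
def sample (W : Sq → Measure Z) {k : ℕ} (x : Fin k → unitInterval) : Sq → Measure Z :=
  fun p => ∑ i : Fin k, ∑ j : Fin k,
    Set.indicator (stepSet k i ×ˢ stepSet k j) (fun _ => W (x i, x j)) p

/-- The probability-graphon associated with the `Z`-weighted complete graph on `k`
vertices with weights `β`. -/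
def graphonOfWeights {k : ℕ} (β : Fin k × Fin k → Z) : Sq → Measure Z :=
  fun p => ∑ i : Fin k, ∑ j : Fin k,
    Set.indicator (stepSet k i ×ˢ stepSet k j) (fun _ => Measure.dirac (β (i, j))) p

/-- The joint law of `(X, (β_{ij}))` where `X` is uniform on `[0,1]^k` and, given `X`,
the weights `β_{ij}` are independent with respective laws `W(X_i, X_j;·)`. -/
def sampleLaw (W : Sq → Measure Z) (k : ℕ) :
    Measure ((Fin k → unitInterval) × (Fin k × Fin k → Z)) :=
  (volume : Measure (Fin k → unitInterval)).bind fun x =>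
    (Measure.pi fun e : Fin k × Fin k => W (x e.1, x e.2)).map (Prod.mk x)


/-! ### Weak convergence of dominated measures -/

theorem WeakTendsto.comp {μ : ℕ → Measure Z} {ν : Measure Z} (h : WeakTendsto μ ν)
    {k : ℕ → ℕ} (hk : Tendsto k atTop atTop) : WeakTendsto (fun n => μ (k n)) ν :=
  fun f => (h f).comp hk

/-- A weakly convergent sequence of probability measures on a Polish space is tight. -/
theorem isTightMeasureSet_range_of_weakTendsto [PolishSpace Z] [BorelSpace Z]
    {M : ℕ → Measure Z} {M' : Measure Z} [∀ n, IsProbabilityMeasure (M n)]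
    [IsProbabilityMeasure M'] (h : WeakTendsto M M') : IsTightMeasureSet (Set.range M) := by
  let := TopologicalSpace.upgradeIsCompletelyMetrizable Z
  let P : ℕ → ProbabilityMeasure Z := fun n => ⟨M n, inferInstance⟩
  let P' : ProbabilityMeasure Z := ⟨M', inferInstance⟩
  have hP : Tendsto P atTop (𝓝 P') :=
    ProbabilityMeasure.tendsto_iff_forall_integral_tendsto.2 h
  have hc : IsCompact (closure (Set.range P)) :=
    hP.isCompact_insert_range.closure_of_subset (Set.subset_insert _ _)
  refine (isTightMeasureSet_of_isCompact_closure hc).subset ?_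
  rintro _ ⟨n, rfl⟩
  exact ⟨P n, ⟨n, rfl⟩, rfl⟩

/-- A sequence of measures dominated by a weakly convergent sequence of probability measures
has a weakly convergent subsequence. -/
theorem exists_subseq_weakTendsto_of_le [PolishSpace Z] [BorelSpace Z]
    {M : ℕ → Measure Z} {M' : Measure Z} [∀ n, IsProbabilityMeasure (M n)]
    [IsProbabilityMeasure M'] (h : WeakTendsto M M') {μ : ℕ → Measure Z}
    (hμ : ∀ n, μ n ≤ M n) :
    ∃ k : ℕ → ℕ, StrictMono k ∧ ∃ ν ∈ SubProb Z, WeakTendsto (fun n => μ (k n)) ν := by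
  have hfin : ∀ n, IsFiniteMeasure (μ n) := fun n => isFiniteMeasure_of_le (M n) (hμ n)
  have mt : Measurable fun z : Z => (z, true) := by fun_prop
  have mf : Measurable fun z : Z => (z, false) := by fun_prop
  let ρ : ℕ → Measure (Z × Bool) := fun n =>
    (μ n).map (fun z => (z, true)) + (M n - μ n).map (fun z => (z, false))
  have hρ : ∀ n (A : Set Z), MeasurableSet A → ρ n (A ×ˢ Set.univ) = M n A := by
    intro n A hA
    have hAu : MeasurableSet (A ×ˢ (Set.univ : Set Bool)) := hA.prod MeasurableSet.univ
    have e := congrArg (fun m : Measure Z => m A) (Measure.sub_add_cancel_of_le (hμ n))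
    simp only [Measure.add_apply] at e
    simp only [ρ, Measure.add_apply, Measure.map_apply mt hAu, Measure.map_apply mf hAu]
    rw [← e, add_comm]
    congr 2 <;> (ext z; simp)
  have hρp : ∀ n, IsProbabilityMeasure (ρ n) := fun n => ⟨by
    rw [← Set.univ_prod_univ, hρ n _ MeasurableSet.univ, measure_univ]⟩
  let R : ℕ → ProbabilityMeasure (Z × Bool) := fun n => ⟨ρ n, hρp n⟩
  have htight : IsTightMeasureSet
      {((m : ProbabilityMeasure (Z × Bool)) : Measure (Z × Bool)) | m ∈ Set.range R} := by
    rw [isTightMeasureSet_iff_exists_isCompact_measure_compl_le]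
    intro ε hε
    obtain ⟨K, hK, hKε⟩ := isTightMeasureSet_iff_exists_isCompact_measure_compl_le.1
      (isTightMeasureSet_range_of_weakTendsto h) ε hε
    refine ⟨K ×ˢ Set.univ, hK.prod isCompact_univ, ?_⟩
    rintro _ ⟨_, ⟨n, rfl⟩, rfl⟩
    have e : (K ×ˢ (Set.univ : Set Bool))ᶜ = Kᶜ ×ˢ Set.univ := by ext; simp
    rw [e]
    exact (hρ n _ hK.measurableSet.compl).trans_le (hKε _ ⟨n, rfl⟩)
  obtain ⟨R', -, k, hk, hlim⟩ := (isCompact_closure_of_isTightMeasureSet htight).tendsto_subseq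
    (fun n => subset_closure (Set.mem_range_self (f := R) n))
  have hR := ProbabilityMeasure.tendsto_iff_forall_integral_tendsto.1 hlim
  let s : Set (Z × Bool) := Prod.snd ⁻¹' {true}
  have hs : MeasurableSet s := measurable_snd (measurableSet_singleton true)
  refine ⟨k, hk, ((R' : Measure (Z × Bool)).restrict s).map Prod.fst, ?_, ?_⟩
  · change Measure.map Prod.fst ((R' : Measure (Z × Bool)).restrict s) Set.univ ≤ 1
    rw [Measure.map_apply measurable_fst MeasurableSet.univ]
    exact prob_le_one.trans' (Measure.restrict_apply_le _ _)
  · intro f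
    let g : BoundedContinuousFunction (Z × Bool) ℝ :=
      BoundedContinuousFunction.ofNormedAddCommGroup
        (fun p => if p.2 = true then f p.1 else 0)
        (by
          have hc : Continuous fun b : Bool => if b = true then (1 : ℝ) else 0 :=
            continuous_of_discreteTopology
          have := (f.continuous.comp continuous_fst).mul
            (hc.comp (continuous_snd : Continuous (Prod.snd : Z × Bool → Bool)))
          convert this using 2 with p
          simp)
        ‖f‖ (by
          intro p
          split_ifs
          · exact f.norm_coe_le_norm p.1
          · simp)
    have hg := hR g
    have h1 : ∀ n, ∫ p, g p ∂(ρ n) = ∫ z, f z ∂(μ n) := by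
      intro n
      have hgm : StronglyMeasurable g := g.continuous.stronglyMeasurable
      have i1 : Integrable g ((μ n).map fun z => (z, true)) := g.integrable _
      have i2 : Integrable g ((M n - μ n).map fun z => (z, false)) := g.integrable _
      rw [integral_add_measure i1 i2, integral_map mt.aemeasurable hgm.aestronglyMeasurable,
        integral_map mf.aemeasurable hgm.aestronglyMeasurable]
      simp [g]
    have h2 : ∫ p, g p ∂(R' : Measure (Z × Bool)) =
        ∫ z, f z ∂((R' : Measure (Z × Bool)).restrict s).map Prod.fst := by
      rw [integral_map measurable_fst.aemeasurable
        f.continuous.stronglyMeasurable.aestronglyMeasurable, ← integral_indicator hs]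
      refine integral_congr_ae (Eventually.of_forall fun p => ?_)
      by_cases hp : p.2 = true <;> simp [g, s, Set.indicator, hp]
    rw [← h2]
    refine hg.congr fun n => ?_
    exact h1 (k n)

/-! ### Measures associated with probability-graphons -/

theorem IsProbGraphon.measurable {W : Sq → Measure Z} (hW : IsProbGraphon W) : Measurable W :=
  Measure.measurable_of_measurable_coe _ hW.1

theorem IsProbGraphon.isProbabilityMeasure_MW {W : Sq → Measure Z} (hW : IsProbGraphon W) :
    IsProbabilityMeasure (MW W) := ⟨by
  rw [MW, Measure.bind_apply MeasurableSet.univ hW.measurable.aemeasurable]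
  have : ∀ p, W p Set.univ = 1 := fun p => (hW.2 p).measure_univ
  simp [this]⟩

theorem IsProbGraphon.kernelInt_le_MW {W : Sq → Measure Z} (hW : IsProbGraphon W) (A : Set Sq) :
    kernelInt W A ≤ MW W := by
  refine Measure.le_iff.2 fun s hs => ?_
  rw [kernelInt, MW, Measure.bind_apply hs hW.measurable.aemeasurable,
    Measure.bind_apply hs hW.measurable.aemeasurable]
  exact lintegral_mono' Measure.restrict_le_self le_rfl

theorem IsProbGraphon.kernelInt_mem_subProb {W : Sq → Measure Z} (hW : IsProbGraphon W)
    (A : Set Sq) : kernelInt W A ∈ SubProb Z :=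
  have := hW.isProbabilityMeasure_MW
  (hW.kernelInt_le_MW A Set.univ).trans prob_le_one

theorem IsProbGraphon.relabel {W : Sq → Measure Z} (hW : IsProbGraphon W)
    {φ : unitInterval → unitInterval} (hφ : IsMP φ) : IsProbGraphon (relabel W φ) :=
  ⟨fun A hA => (hW.1 A hA).comp (hφ.measurable.prodMap hφ.measurable), fun _ => hW.2 _⟩

theorem IsProbGraphon.MW_relabel {W : Sq → Measure Z} (hW : IsProbGraphon W)
    {φ : unitInterval → unitInterval} (hφ : IsMP φ) : MW (PG.relabel W φ) = MW W := by
  have hmp : MeasurePreserving (Prod.map φ φ) (volume : Measure Sq) (volume : Measure Sq) :=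
    MeasurePreserving.prod hφ hφ
  ext s hs
  rw [MW, MW, Measure.bind_apply hs (hW.relabel hφ).measurable.aemeasurable,
    Measure.bind_apply hs hW.measurable.aemeasurable]
  exact hmp.lintegral_comp (hW.1 s hs)

/-! ### Comparison of cut distances -/

/-- A distance inducing the weak topology is jointly sequentially continuous. -/
theorem InducesWeakTopologySub.tendsto {dm : Measure Z → Measure Z → ℝ}
    (hweak : InducesWeakTopologySub dm) (hdm : IsDistOnSubProb dm) {μ ν : ℕ → Measure Z}
    {μ' ν' : Measure Z} (hμ : ∀ n, μ n ∈ SubProb Z) (hν : ∀ n, ν n ∈ SubProb Z)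
    (hμ' : μ' ∈ SubProb Z) (hν' : ν' ∈ SubProb Z) (h : WeakTendsto μ μ')
    (h' : WeakTendsto ν ν') : Tendsto (fun n => dm (μ n) (ν n)) atTop (𝓝 (dm μ' ν')) := by
  obtain ⟨hsymm, -, htri, -⟩ := hdm
  rw [tendsto_iff_dist_tendsto_zero]
  have hsum := ((hweak μ μ' hμ hμ').2 h).add ((hweak ν ν' hν hν').2 h')
  rw [add_zero] at hsum
  refine squeeze_zero (fun _ => dist_nonneg) (fun n => ?_) hsum
  rw [Real.dist_eq, abs_sub_le_iff]
  have a1 := htri _ (hμ n) _ hμ' _ (hν n)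
  have a2 := htri _ hμ' _ hν' _ (hν n)
  have a3 := htri _ hμ' _ (hμ n) _ hν'
  have a4 := htri _ (hμ n) _ (hν n) _ hν'
  have a5 := hsymm _ hν' _ (hν n)
  have a6 := hsymm _ hμ' _ (hμ n)
  constructor <;> linarith

/-- For probability-graphons with weakly convergent total measures, the pairs of measures of any
sequence of sets converge weakly along a subsequence. -/
theorem exists_subseq_weakTendsto_kernelInt [PolishSpace Z] [BorelSpace Z]
    {U V : ℕ → Sq → Measure Z} (hU : ∀ n, IsProbGraphon (U n)) (hV : ∀ n, IsProbGraphon (V n))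
    {M N : Measure Z} [IsProbabilityMeasure M] [IsProbabilityMeasure N]
    (hM : WeakTendsto (fun n => MW (U n)) M) (hN : WeakTendsto (fun n => MW (V n)) N)
    (A : ℕ → Set Sq) :
    ∃ k : ℕ → ℕ, StrictMono k ∧ ∃ μ ∈ SubProb Z, ∃ ν ∈ SubProb Z,
      WeakTendsto (fun n => kernelInt (U (k n)) (A (k n))) μ ∧
      WeakTendsto (fun n => kernelInt (V (k n)) (A (k n))) ν := by
  have := fun n => (hU n).isProbabilityMeasure_MW
  have := fun n => (hV n).isProbabilityMeasure_MW
  obtain ⟨k, hk, μ, hμ, hkμ⟩ :=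
    exists_subseq_weakTendsto_of_le hM fun n => (hU n).kernelInt_le_MW (A n)
  obtain ⟨l, hl, ν, hν, hlν⟩ := exists_subseq_weakTendsto_of_le (hN.comp hk.tendsto_atTop)
    fun n => (hV (k n)).kernelInt_le_MW (A (k n))
  exact ⟨k ∘ l, hk.comp hl, μ, hμ, ν, hν, hkμ.comp hl.tendsto_atTop, hlν⟩

theorem bddAbove_range_cutDist [PolishSpace Z] [BorelSpace Z] {dm : Measure Z → Measure Z → ℝ}
    (hdm : IsDistOnSubProb dm) (hweak : InducesWeakTopologySub dm) {U V : Sq → Measure Z}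
    (hU : IsProbGraphon U) (hV : IsProbGraphon V) :
    BddAbove (Set.range fun A : Set Sq => dm (kernelInt U A) (kernelInt V A)) := by
  by_contra hb
  have hlarge : ∀ n : ℕ, ∃ A : Set Sq, (n : ℝ) < dm (kernelInt U A) (kernelInt V A) := by
    intro n
    obtain ⟨_, ⟨A, rfl⟩, hA⟩ := not_bddAbove_iff.1 hb n
    exact ⟨A, hA⟩
  choose A hA using hlarge
  have := hU.isProbabilityMeasure_MW
  have := hV.isProbabilityMeasure_MW
  obtain ⟨k, hk, μ, hμ, ν, hν, hkμ, hkν⟩ := exists_subseq_weakTendsto_kernelInt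
    (fun _ => hU) (fun _ => hV) (M := MW U) (N := MW V) (fun _ => tendsto_const_nhds)
    (fun _ => tendsto_const_nhds) A
  have hlim := hweak.tendsto hdm (fun n => hU.kernelInt_mem_subProb (A (k n)))
    (fun n => hV.kernelInt_mem_subProb (A (k n))) hμ hν hkμ hkν
  refine not_tendsto_nhds_of_tendsto_atTop ?_ _ hlim
  exact tendsto_atTop_mono (fun n => (hA (k n)).le)
    (tendsto_natCast_atTop_atTop.comp hk.tendsto_atTop)

theorem le_cutDist [PolishSpace Z] [BorelSpace Z] {dm : Measure Z → Measure Z → ℝ}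
    (hdm : IsDistOnSubProb dm) (hweak : InducesWeakTopologySub dm) {U V : Sq → Measure Z}
    (hU : IsProbGraphon U) (hV : IsProbGraphon V) {S T : Set unitInterval}
    (hS : MeasurableSet S) (hT : MeasurableSet T) :
    dm (kernelInt U (S ×ˢ T)) (kernelInt V (S ×ˢ T)) ≤ cutDist dm U V := by
  refine le_ciSup (f := fun ST : {p : Set unitInterval × Set unitInterval //
      MeasurableSet p.1 ∧ MeasurableSet p.2} =>
    dm (kernelInt U (ST.val.1 ×ˢ ST.val.2)) (kernelInt V (ST.val.1 ×ˢ ST.val.2)))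
    ((bddAbove_range_cutDist hdm hweak hU hV).mono ?_) ⟨(S, T), hS, hT⟩
  rintro _ ⟨ST, rfl⟩
  exact ⟨_, rfl⟩

theorem cutDist_nonneg {dm : Measure Z → Measure Z → ℝ} (hdm : IsDistOnSubProb dm)
    {U V : Sq → Measure Z} (hU : IsProbGraphon U) (hV : IsProbGraphon V) :
    0 ≤ cutDist dm U V :=
  Real.iSup_nonneg fun _ =>
    hdm.2.1 _ (hU.kernelInt_mem_subProb _) _ (hV.kernelInt_mem_subProb _)

/-- Distances inducing the weak topology have equivalent cut distances along sequences
`(U n, V n)` for which the total measure of `V n` is constant. -/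
theorem tendsto_cutDist_of_tendsto_cutDist [PolishSpace Z] [BorelSpace Z]
    {dm dm' : Measure Z → Measure Z → ℝ}
    (hdm : IsDistOnSubProb dm) (hdm' : IsDistOnSubProb dm')
    (hweak : InducesWeakTopologySub dm) (hweak' : InducesWeakTopologySub dm')
    {U V : ℕ → Sq → Measure Z} (hU : ∀ n, IsProbGraphon (U n)) (hV : ∀ n, IsProbGraphon (V n))
    {M : Measure Z} [IsProbabilityMeasure M] (hM : ∀ n, MW (V n) = M)
    (h : Tendsto (fun n => cutDist dm (U n) (V n)) atTop (𝓝 0)) :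
    Tendsto (fun n => cutDist dm' (U n) (V n)) atTop (𝓝 0) := by
  have huniv : ∀ W : Sq → Measure Z, kernelInt W (Set.univ ×ˢ Set.univ) = MW W := fun W => by
    rw [kernelInt, Set.univ_prod_univ, Measure.restrict_univ, MW]
  have hsub : ∀ n, MW (U n) ∈ SubProb Z := fun n => by
    rw [← huniv]
    exact (hU n).kernelInt_mem_subProb _
  have hMsub : M ∈ SubProb Z := prob_le_one (μ := M)
  have hUM : WeakTendsto (fun n => MW (U n)) M := by
    refine (hweak _ M hsub hMsub).1
      (squeeze_zero (fun n => hdm.2.1 _ (hsub n) _ hMsub) (fun n => ?_) h)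
    have := le_cutDist hdm hweak (hU n) (hV n) MeasurableSet.univ MeasurableSet.univ
    rwa [huniv, huniv, hM] at this
  have hVM : WeakTendsto (fun n => MW (V n)) M := fun f => by
    simp only [hM]
    exact tendsto_const_nhds
  have happrox : ∀ n : ℕ, ∃ S T : Set unitInterval, MeasurableSet S ∧ MeasurableSet T ∧
      cutDist dm' (U n) (V n) ≤
        dm' (kernelInt (U n) (S ×ˢ T)) (kernelInt (V n) (S ×ˢ T)) + 1 / ((n : ℝ) + 1) := by
    intro n
    have : Nonempty {p : Set unitInterval × Set unitInterval //
      MeasurableSet p.1 ∧ MeasurableSet p.2} := ⟨(∅, ∅), by simp⟩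
    have hlt : cutDist dm' (U n) (V n) - 1 / ((n : ℝ) + 1) < cutDist dm' (U n) (V n) :=
      sub_lt_self _ Nat.one_div_pos_of_nat
    obtain ⟨ST, hST⟩ := exists_lt_of_lt_ciSup hlt
    exact ⟨ST.1.1, ST.1.2, ST.2.1, ST.2.2, by linarith⟩
  choose S T hS hT hST using happrox
  refine tendsto_of_subseq_tendsto fun ns hns => ?_
  obtain ⟨k, hk, μ, hμ, ν, hν, hkμ, hkν⟩ := exists_subseq_weakTendsto_kernelInt
    (fun n => hU (ns n)) (fun n => hV (ns n)) (hUM.comp hns) (hVM.comp hns)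
    (fun n => S (ns n) ×ˢ T (ns n))
  have hnk : Tendsto (fun n => ns (k n)) atTop atTop := hns.comp hk.tendsto_atTop
  have mU := fun n => (hU (ns (k n))).kernelInt_mem_subProb (S (ns (k n)) ×ˢ T (ns (k n)))
  have mV := fun n => (hV (ns (k n))).kernelInt_mem_subProb (S (ns (k n)) ×ˢ T (ns (k n)))
  have hzero : dm μ ν = 0 :=
    tendsto_nhds_unique (hweak.tendsto hdm mU mV hμ hν hkμ hkν)
      (squeeze_zero (fun n => hdm.2.1 _ (mU n) _ (mV n))
        (fun n => le_cutDist hdm hweak (hU _) (hV _) (hS _) (hT _)) (h.comp hnk))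
  have hzero' : dm' μ ν = 0 :=
    (hdm'.2.2.2 _ hμ _ hν).2 ((hdm.2.2.2 _ hμ _ hν).1 hzero)
  have hlim := (hweak'.tendsto hdm' mU mV hμ hν hkμ hkν).add
    ((tendsto_one_div_add_atTop_nhds_zero_nat (𝕜 := ℝ)).comp hnk)
  rw [hzero', add_zero] at hlim
  exact ⟨k, squeeze_zero (fun n => cutDist_nonneg hdm' (hU _) (hV _)) (fun n => hST _) hlim⟩

theorem tendsto_deltaCut_of_tendsto_deltaCut [PolishSpace Z] [BorelSpace Z]
    {dm dm' : Measure Z → Measure Z → ℝ}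
    (hdm : IsDistOnSubProb dm) (hdm' : IsDistOnSubProb dm')
    (hweak : InducesWeakTopologySub dm) (hweak' : InducesWeakTopologySub dm')
    {Wn : ℕ → Sq → Measure Z} {W : Sq → Measure Z}
    (hWn : ∀ n, IsProbGraphon (Wn n)) (hW : IsProbGraphon W)
    (h : Tendsto (fun n => deltaCut (cutDist dm) (Wn n) W) atTop (𝓝 0)) :
    Tendsto (fun n => deltaCut (cutDist dm') (Wn n) W) atTop (𝓝 0) := by
  have happrox : ∀ n : ℕ, ∃ φ : {φ : unitInterval → unitInterval // IsMP φ ∧ φ.Bijective},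
      cutDist dm (Wn n) (relabel W φ) ≤
        deltaCut (cutDist dm) (Wn n) W + 1 / ((n : ℝ) + 1) := by
    intro n
    have : Nonempty {φ : unitInterval → unitInterval // IsMP φ ∧ φ.Bijective} :=
      ⟨id, MeasurePreserving.id _, Function.bijective_id⟩
    obtain ⟨φ, hφ⟩ := exists_lt_of_ciInf_lt
      (lt_add_of_pos_right (deltaCut (cutDist dm) (Wn n) W)
        (Nat.one_div_pos_of_nat : (0 : ℝ) < 1 / ((n : ℝ) + 1)))
    exact ⟨φ, hφ.le⟩
  choose φ hφ using happrox
  have hlim := h.add (tendsto_one_div_add_atTop_nhds_zero_nat (𝕜 := ℝ))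
  rw [add_zero] at hlim
  have hV : ∀ n, IsProbGraphon (relabel W (φ n).1) := fun n => hW.relabel (φ n).2.1
  have := hW.isProbabilityMeasure_MW
  have hcut := tendsto_cutDist_of_tendsto_cutDist hdm hdm' hweak hweak' hWn hV
    (fun n => hW.MW_relabel (φ n).2.1)
    (squeeze_zero (fun n => cutDist_nonneg hdm (hWn n) (hV n)) hφ hlim)
  refine squeeze_zero (fun n => Real.iInf_nonneg fun ψ =>
    cutDist_nonneg hdm' (hWn n) (hW.relabel ψ.2.1)) (fun n => ?_) hcut
  refine ciInf_le (f := fun ψ : {φ : unitInterval → unitInterval // IsMP φ ∧ φ.Bijective} =>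
    cutDist dm' (Wn n) (relabel W ψ.1)) ⟨0, ?_⟩ (φ n)
  rintro _ ⟨ψ, rfl⟩
  exact cutDist_nonneg hdm' (hWn n) (hW.relabel ψ.2.1)

/-- **Equivalence of the topologies induced by the unlabeled cut distances.**
Let `d_m` and `d_m'` be two distances on `ℳ≤1(Z)`, each inducing the weak topology on
`ℳ≤1(Z)`, whose cut distances `d_{□,m}` and `d_{□,m'}` on `𝒲₁` are each smooth, weakly
regular and regular with respect to the stepping operator (cut distances are
automatically invariant).  Then `δ_{□,m}` and `δ_{□,m'}` induce the same topology on
`𝒲̃₁`: for every sequence `(W_n)` and every `W` in `𝒲₁`,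
`δ_{□,m}(W_n, W) → 0` if and only if `δ_{□,m'}(W_n, W) → 0`. -/
theorem equivalence_of_cut_distance_topologies
    {Z : Type*} [MeasurableSpace Z] [TopologicalSpace Z] [PolishSpace Z] [BorelSpace Z]
    (dm dm' : Measure Z → Measure Z → ℝ)
    (hdm : IsDistOnSubProb dm) (hdm' : IsDistOnSubProb dm')
    (hweak : InducesWeakTopologySub dm) (hweak' : InducesWeakTopologySub dm')
    (hsmooth : Smooth (cutDist dm)) (hsmooth' : Smooth (cutDist dm'))
    (hreg : WeaklyRegular (cutDist dm)) (hreg' : WeaklyRegular (cutDist dm'))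
    (hstep : SteppingRegular (cutDist dm)) (hstep' : SteppingRegular (cutDist dm'))
    (Wn : ℕ → Sq → Measure Z) (W : Sq → Measure Z)
    (hWn : ∀ n, IsProbGraphon (Wn n)) (hW : IsProbGraphon W) :
    Tendsto (fun n => deltaCut (cutDist dm) (Wn n) W) atTop (𝓝 0) ↔
      Tendsto (fun n => deltaCut (cutDist dm') (Wn n) W) atTop (𝓝 0) := by
  exact ⟨tendsto_deltaCut_of_tendsto_deltaCut hdm hdm' hweak hweak' hWn hW,
    tendsto_deltaCut_of_tendsto_deltaCut hdm' hdm hweak' hweak hWn hW⟩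

end PG
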